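/- Let N ≥ 3 be an odd integer and κ ∈ (0,1), and let G be the N×N matrix with entries G_{jk} = ψ_k(1, θ_j). Then the matrix Gᵀ·G is diagonal, and its diagonal entries are: [GᵀG]_{1,1} = N², and [GᵀG]_{k,k} = (N²/4)·(1 + κ^{N−2m})² when k = 2m or k = 2m+1 for some m ∈ {1,…,(N−1)/2}. -/

import Mathlib

open Matrix

/-- The DSM-QR basis function `ψ_k(s,θ)` (1-based index `k`): `ψ_1(s,θ) = √N` and, for
`m = 1,…,(N−1)/2`, `ψ_{2m}(s,θ) = √(N/2)(s^m sin(mθ) − κ^{N−2m} s^{N−m} sin((N−m)θ))`,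
`ψ_{2m+1}(s,θ) = √(N/2)(s^m cos(mθ) + κ^{N−2m} s^{N−m} cos((N−m)θ))`. -/
noncomputable def psi (N : ℕ) (κ : ℝ) (k : ℕ) (s θ : ℝ) : ℝ :=
  if k = 1 then Real.sqrt N
  else if k % 2 = 0 then
    Real.sqrt ((N : ℝ) / 2) *
      (s ^ (k / 2) * Real.sin ((k / 2 : ℕ) * θ) -
        κ ^ (N - 2 * (k / 2)) * s ^ (N - k / 2) * Real.sin (((N - k / 2 : ℕ) : ℝ) * θ))
  else
    Real.sqrt ((N : ℝ) / 2) *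
      (s ^ (k / 2) * Real.cos ((k / 2 : ℕ) * θ) +
        κ ^ (N - 2 * (k / 2)) * s ^ (N - k / 2) * Real.cos (((N - k / 2 : ℕ) : ℝ) * θ))

/-- The collocation angle `θ_j = 2πj/N`. -/
noncomputable def theta (N : ℕ) (j : ℕ) : ℝ := 2 * Real.pi * j / N

/-- The DSM-QR collocation matrix `G`, with `G_{jk} = ψ_k(1, θ_j)` (1-based `j,k`). -/
noncomputable def Gmat (N : ℕ) (κ : ℝ) : Matrix (Fin N) (Fin N) ℝ := fun j k =>
  psi N κ (k.val + 1) 1 (theta N (j.val + 1))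

theorem sum_cexp_mul_theta {N : ℕ} {a : ℤ} (ha : |a| < N) :
    ∑ j : Fin N, Complex.exp (((a * theta N (j.val + 1) : ℝ) : ℂ) * Complex.I) =
      if a = 0 then (N : ℂ) else 0 := by
  split_ifs with h
  · simp [h]
  have hN : (N : ℂ) ≠ 0 := by
    have : (0 : ℤ) < N := (abs_nonneg a).trans_lt ha
    exact_mod_cast this.ne'
  set w : ℂ := Complex.exp (2 * Real.pi * Complex.I * (a / N)) with hw
  have hterm (j : ℕ) : Complex.exp (((a * theta N (j + 1) : ℝ) : ℂ) * Complex.I) = w * w ^ j := by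
    rw [← pow_succ', hw, ← Complex.exp_nat_mul]
    congr 1
    simp only [theta]
    push_cast
    ring
  have hwN : w ^ N = 1 := by
    rw [hw, ← Complex.exp_nat_mul, Complex.exp_eq_one_iff]
    exact ⟨a, by field_simp⟩
  have hw1 : w ≠ 1 := by
    rw [hw, Ne, Complex.exp_eq_one_iff]
    rintro ⟨n, hn⟩
    have hn' : (a : ℂ) / N = n :=
      mul_left_cancel₀ Complex.two_pi_I_ne_zero (by rw [hn]; ring)
    rw [div_eq_iff hN] at hn'
    have hdvd : (N : ℤ) ∣ a := ⟨n, by rw [mul_comm]; exact_mod_cast hn'⟩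
    exact h (Int.eq_zero_of_abs_lt_dvd hdvd ha)
  simp_rw [hterm]
  rw [← Finset.mul_sum, Fin.sum_univ_eq_sum_range (fun j => w ^ j), geom_sum_eq hw1, hwN]
  simp

theorem sum_cos_mul_theta {N : ℕ} {a : ℤ} (ha : |a| < N) :
    ∑ j : Fin N, Real.cos (a * theta N (j.val + 1)) = if a = 0 then (N : ℝ) else 0 := by
  have h := congrArg Complex.re (sum_cexp_mul_theta ha)
  simp only [Complex.re_sum, Complex.exp_ofReal_mul_I_re] at h
  rw [h]
  split_ifs <;> simp

theorem sum_sin_mul_theta {N : ℕ} {a : ℤ} (ha : |a| < N) :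
    ∑ j : Fin N, Real.sin (a * theta N (j.val + 1)) = 0 := by
  have h := congrArg Complex.im (sum_cexp_mul_theta ha)
  simp only [Complex.im_sum, Complex.exp_ofReal_mul_I_im] at h
  rw [h]
  split_ifs <;> simp

theorem sum_cos_mul_cos {N m n : ℕ} (h : m + n < N) :
    ∑ j : Fin N, Real.cos (m * theta N (j.val + 1)) * Real.cos (n * theta N (j.val + 1)) =
      ((if m = n then (N : ℝ) else 0) + if m + n = 0 then (N : ℝ) else 0) / 2 := by
  have h₁ := sum_cos_mul_theta (N := N) (a := m - n) (by rw [abs_lt]; omega)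
  have h₂ := sum_cos_mul_theta (N := N) (a := (m + n : ℕ)) (by rw [abs_lt]; omega)
  simp only [sub_eq_zero, Nat.cast_inj] at h₁
  simp only [Nat.cast_eq_zero] at h₂
  rw [← h₁, ← h₂, ← Finset.sum_add_distrib, Finset.sum_div]
  refine Finset.sum_congr rfl fun j _ => ?_
  push_cast
  rw [sub_mul, add_mul, Real.cos_sub, Real.cos_add]
  ring

theorem sum_sin_mul_sin {N m n : ℕ} (h : m + n < N) :
    ∑ j : Fin N, Real.sin (m * theta N (j.val + 1)) * Real.sin (n * theta N (j.val + 1)) =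
      ((if m = n then (N : ℝ) else 0) - if m + n = 0 then (N : ℝ) else 0) / 2 := by
  have h₁ := sum_cos_mul_theta (N := N) (a := m - n) (by rw [abs_lt]; omega)
  have h₂ := sum_cos_mul_theta (N := N) (a := (m + n : ℕ)) (by rw [abs_lt]; omega)
  simp only [sub_eq_zero, Nat.cast_inj] at h₁
  simp only [Nat.cast_eq_zero] at h₂
  rw [← h₁, ← h₂, ← Finset.sum_sub_distrib, Finset.sum_div]
  refine Finset.sum_congr rfl fun j _ => ?_
  push_cast
  rw [sub_mul, add_mul, Real.cos_sub, Real.cos_add]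
  ring

theorem sum_sin_mul_cos {N m n : ℕ} (h : m + n < N) :
    ∑ j : Fin N, Real.sin (m * theta N (j.val + 1)) * Real.cos (n * theta N (j.val + 1)) = 0 := by
  have h₁ := sum_sin_mul_theta (N := N) (a := m - n) (by rw [abs_lt]; omega)
  have h₂ := sum_sin_mul_theta (N := N) (a := m + n) (by rw [abs_lt]; omega)
  have h₃ : (0 : ℝ) = (0 + 0) / 2 := by norm_num
  rw [h₃]
  nth_rewrite 1 [← h₁]
  rw [← h₂, ← Finset.sum_add_distrib, Finset.sum_div]
  refine Finset.sum_congr rfl fun j _ => ?_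
  push_cast
  rw [sub_mul, add_mul, Real.sin_sub, Real.sin_add]
  ring

theorem sub_mul_theta {N m : ℕ} (hN : N ≠ 0) (hm : m ≤ N) (j : ℕ) :
    ((N - m : ℕ) : ℝ) * theta N j = j * (2 * Real.pi) - m * theta N j := by
  have : (N : ℝ) ≠ 0 := by exact_mod_cast hN
  rw [Nat.cast_sub hm, theta]
  field_simp

/-- The norm factor of the column `k` (0-based) of `Gmat N κ`. -/
noncomputable def colScale (N : ℕ) (κ : ℝ) (k : ℕ) : ℝ :=
  if k = 0 then Real.sqrt N
  else Real.sqrt ((N : ℝ) / 2) * (1 + κ ^ (N - 2 * ((k + 1) / 2)))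

/-- The real Fourier mode of the column `k` (0-based) of `Gmat N κ`. -/
noncomputable def colMode (k : ℕ) (θ : ℝ) : ℝ :=
  if k % 2 = 1 then Real.sin (((k + 1) / 2 : ℕ) * θ) else Real.cos (((k + 1) / 2 : ℕ) * θ)

theorem Gmat_apply {N : ℕ} (κ : ℝ) (j k : Fin N) :
    Gmat N κ j k = colScale N κ k * colMode k (theta N (j.val + 1)) := by
  obtain ⟨k, hk⟩ := k
  have hθ := sub_mul_theta (N := N) (m := (k + 1) / 2) (by omega) (by omega) (j.val + 1)
  have hs := (Real.sin_nat_mul_two_pi_sub · (j.val + 1))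
  have hc := (Real.cos_nat_mul_two_pi_sub · (j.val + 1))
  simp only [Gmat, psi, colScale, colMode, hθ, hs, hc, one_pow]
  rcases eq_or_ne k 0 with rfl | hk0
  · simp
  rcases Nat.mod_two_eq_zero_or_one k with h | h
  · have h' : (k + 1) % 2 ≠ 0 := by omega
    simp [h, h', hk0]
    ring
  · have h' : (k + 1) % 2 = 0 := by omega
    simp [h, h', hk0]
    ring

theorem sum_colMode_mul_colMode {N : ℕ} (hN : Odd N) (k l : Fin N) :
    ∑ j : Fin N, colMode k (theta N (j.val + 1)) * colMode l (theta N (j.val + 1)) =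
      if k = l then (if k.val = 0 then (N : ℝ) else N / 2) else 0 := by
  obtain ⟨k, hk⟩ := k
  obtain ⟨l, hl⟩ := l
  obtain ⟨M, rfl⟩ := hN
  have hm : (k + 1) / 2 + (l + 1) / 2 < 2 * M + 1 := by omega
  simp only [colMode, Fin.mk.injEq]
  rcases Nat.mod_two_eq_zero_or_one k with h | h <;>
    rcases Nat.mod_two_eq_zero_or_one l with h' | h' <;>
    simp only [h, h', zero_ne_one, if_true, if_false]
  · rw [sum_cos_mul_cos hm]
    split_ifs <;> first | omega | ring
  · simp_rw [mul_comm (Real.cos _)]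
    rw [sum_sin_mul_cos (by omega), if_neg (by omega)]
  · rw [sum_sin_mul_cos hm, if_neg (by omega)]
  · rw [sum_sin_mul_sin hm]
    split_ifs <;> first | omega | ring

theorem transpose_Gmat_mul_Gmat_apply {N : ℕ} (hN : Odd N) (κ : ℝ) (k l : Fin N) :
    ((Gmat N κ)ᵀ * Gmat N κ) k l =
      colScale N κ k * colScale N κ l *
        if k = l then (if k.val = 0 then (N : ℝ) else N / 2) else 0 := by
  rw [← sum_colMode_mul_colMode hN, Finset.mul_sum, Matrix.mul_apply]
  refine Finset.sum_congr rfl fun j _ => ?_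
  rw [Matrix.transpose_apply, Gmat_apply, Gmat_apply]
  ring

theorem GtG_diagonal (N : ℕ) (hNodd : Odd N) (hN3 : 3 ≤ N)
    (κ : ℝ) (hκ : κ ∈ Set.Ioo (0 : ℝ) 1) :
    ((Gmat N κ)ᵀ * Gmat N κ).IsDiag ∧
    (∀ k : Fin N,
      ((Gmat N κ)ᵀ * Gmat N κ) k k =
        if k.val = 0 then (N : ℝ) ^ 2
        else (N : ℝ) ^ 2 / 4 * (1 + κ ^ (N - 2 * ((k.val + 1) / 2))) ^ 2) := by
  refine ⟨fun k l hkl => ?_, fun k => ?_⟩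
  · simp [transpose_Gmat_mul_Gmat_apply hNodd, hkl]
  · rw [transpose_Gmat_mul_Gmat_apply hNodd, if_pos rfl, colScale]
    split_ifs
    · rw [Real.mul_self_sqrt (by positivity)]
      ring
    · rw [mul_mul_mul_comm, Real.mul_self_sqrt (by positivity)]
      ring
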